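/- Fix γ, k ∈ (0,1). For z = (x,y) ∈ ℝ^d × {0,1} and β ∈ ℝ^d define l(β;z) = log[q·(1−γ)^y γ^{1−y} + (1−q)·(1−γ^k)^y γ^{k(1−y)}] with q = (1+e^{−xᵀβ})^{−1}. Then: (a) for all β and z, min(log(1−γ^k), log γ) ≤ l(β;z) ≤ max(log(1−γ), log(γ^k)); (b) the gradient in β satisfies ‖∇l(β;(x,1))‖ ≤ ((γ^k−γ)/(1−γ^k))·‖x‖ and ‖∇l(β;(x,0))‖ ≤ ((γ^k−γ)/γ)·‖x‖; consequently (c) for all β₁, β₂ ∈ ℝ^d and all z = (x,y), |l(β₁;z) − l(β₂;z)| ≤ (γ^k−γ)·max(1/(1−γ^k), 1/γ)·‖x‖·‖β₁ − β₂‖. -/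

import Mathlib

open scoped BigOperators

noncomputable section

/-- Inner product `xᵀβ`. -/
def dotp {d : ℕ} (x β : EuclideanSpace ℝ (Fin d)) : ℝ := ∑ i, x i * β i

/-- The quasi log-likelihood term
`l(β;(x,y)) = log[q(1−γ)^y γ^{1−y} + (1−q)(1−γ^k)^y γ^{k(1−y)}]`, `q = (1+e^{−xᵀβ})⁻¹`. -/
def lfun {d : ℕ} (γ k : ℝ) (x : EuclideanSpace ℝ (Fin d)) (y : ℝ)
    (β : EuclideanSpace ℝ (Fin d)) : ℝ :=
  Real.log ((1 + Real.exp (-dotp x β))⁻¹ * ((1 - γ) ^ y * γ ^ (1 - y))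
    + (1 - (1 + Real.exp (-dotp x β))⁻¹) * ((1 - γ ^ k) ^ y * γ ^ (k * (1 - y))))

theorem dotp_eq {d : ℕ} (x β : EuclideanSpace ℝ (Fin d)) : dotp x β = innerSL ℝ x β := by
  simp [dotp, PiLp.inner_apply, mul_comm]

theorem q_mem (t : ℝ) : 0 < (1 + Real.exp (-t))⁻¹ ∧ (1 + Real.exp (-t))⁻¹ < 1 := by
  have := Real.exp_pos (-t)
  refine ⟨by positivity, inv_lt_one_of_one_lt₀ (by linarith)⟩

theorem mix_bd (q a b m M : ℝ) (hq : 0 < q ∧ q < 1) (ha : m ≤ a) (hb : m ≤ b) (ha' : a ≤ M)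
    (hb' : b ≤ M) : m ≤ q * a + (1 - q) * b ∧ q * a + (1 - q) * b ≤ M := by
  obtain ⟨h0, h1⟩ := hq
  constructor <;> nlinarith

theorem core_deriv {d : ℕ} (x : EuclideanSpace ℝ (Fin d)) (a b m : ℝ) (hm : 0 < m)
    (ha : m ≤ a) (hb : m ≤ b) (f : EuclideanSpace ℝ (Fin d) → ℝ)
    (hf : ∀ β, f β = Real.log ((1 + Real.exp (-dotp x β))⁻¹ * a
      + (1 - (1 + Real.exp (-dotp x β))⁻¹) * b)) (β : EuclideanSpace ℝ (Fin d)) :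
    DifferentiableAt ℝ f β ∧ ‖fderiv ℝ f β‖ ≤ |a - b| / m * ‖x‖ := by
  set g : ℝ → ℝ := fun t => Real.log ((1 + Real.exp (-t))⁻¹ * a
      + (1 - (1 + Real.exp (-t))⁻¹) * b) with hg
  have hfg : f = fun β => g (innerSL ℝ x β) := by
    funext β
    rw [hf, dotp_eq]
  set t := innerSL ℝ x β with ht
  set q := (1 + Real.exp (-t))⁻¹ with hqd
  have hq := q_mem t
  rw [← hqd] at hq
  have hpos : m ≤ q * a + (1 - q) * b :=
    (mix_bd q a b m (max a b) hq ha hb (le_max_left _ _) (le_max_right _ _)).1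
  have hE := Real.exp_pos (-t)
  have hs : HasDerivAt (fun t : ℝ => (1 + Real.exp (-t))⁻¹) (q * (1 - q)) t := by
    have h1 : HasDerivAt (fun t : ℝ => 1 + Real.exp (-t)) (Real.exp (-t) * (-1)) t :=
      ((hasDerivAt_neg t).exp).const_add 1
    have h2 := h1.inv (by positivity)
    have e : q * (1 - q) = -(Real.exp (-t) * -1) / (1 + Real.exp (-t)) ^ 2 := by
      rw [hqd]
      field_simp
      ring
    rw [e]
    exact h2
  have hg' : HasDerivAt g (((q * (1 - q)) * a + (-(q * (1 - q))) * b) / (q * a + (1 - q) * b)) t :=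
    ((hs.mul_const a).add ((hs.const_sub 1).mul_const b)).log (by
      show q * a + (1 - q) * b ≠ 0
      linarith)
  have hF : HasFDerivAt f ((((q * (1 - q)) * a + (-(q * (1 - q))) * b) /
      (q * a + (1 - q) * b)) • innerSL ℝ x) β := by
    rw [hfg]
    exact hg'.comp_hasFDerivAt β (innerSL ℝ x).hasFDerivAt
  refine ⟨hF.differentiableAt, ?_⟩
  rw [hF.fderiv, norm_smul, innerSL_apply_norm]
  refine mul_le_mul_of_nonneg_right ?_ (norm_nonneg _)
  have e : (q * (1 - q)) * a + (-(q * (1 - q))) * b = (q * (1 - q)) * (a - b) := by ring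
  rw [e, Real.norm_eq_abs, abs_div, abs_mul, abs_of_pos (lt_of_lt_of_le hm hpos)]
  obtain ⟨h0, h1⟩ := hq
  refine div_le_div₀ (abs_nonneg _) ?_ hm hpos
  have : |q * (1 - q)| ≤ 1 := by
    rw [abs_of_nonneg (by nlinarith)]
    nlinarith
  nlinarith [abs_nonneg (a - b)]

theorem core_lip {d : ℕ} (f : EuclideanSpace ℝ (Fin d) → ℝ) (C : ℝ)
    (h : ∀ β, DifferentiableAt ℝ f β ∧ ‖fderiv ℝ f β‖ ≤ C) (u v : EuclideanSpace ℝ (Fin d)) :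
    |f u - f v| ≤ C * ‖u - v‖ := by
  have := Convex.norm_image_sub_le_of_norm_fderiv_le (𝕜 := ℝ) (f := f) (C := C) (s := Set.univ)
    (fun β _ => (h β).1) (fun β _ => (h β).2) convex_univ (Set.mem_univ v) (Set.mem_univ u)
  simpa using this

/-- uniform boundedness of `l`, the gradient bounds
`‖∇l(β;(x,1))‖ ≤ ((γ^k−γ)/(1−γ^k))‖x‖`, `‖∇l(β;(x,0))‖ ≤ ((γ^k−γ)/γ)‖x‖`, and the resulting
Lipschitz property in `β`. -/
theorem stmt_18 {d : ℕ} (γ k : ℝ) (hγ : γ ∈ Set.Ioo (0:ℝ) 1) (hk : k ∈ Set.Ioo (0:ℝ) 1) :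
    (∀ (x : EuclideanSpace ℝ (Fin d)) (y : ℝ), (y = 0 ∨ y = 1) → ∀ β,
        min (Real.log (1 - γ ^ k)) (Real.log γ) ≤ lfun γ k x y β ∧
        lfun γ k x y β ≤ max (Real.log (1 - γ)) (Real.log (γ ^ k))) ∧
    (∀ (x : EuclideanSpace ℝ (Fin d)) (β : EuclideanSpace ℝ (Fin d)),
        ‖fderiv ℝ (lfun γ k x 1) β‖ ≤ (γ ^ k - γ) / (1 - γ ^ k) * ‖x‖ ∧
        ‖fderiv ℝ (lfun γ k x 0) β‖ ≤ (γ ^ k - γ) / γ * ‖x‖) ∧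
    (∀ (x : EuclideanSpace ℝ (Fin d)) (y : ℝ), (y = 0 ∨ y = 1) →
        ∀ β₁ β₂ : EuclideanSpace ℝ (Fin d),
        |lfun γ k x y β₁ - lfun γ k x y β₂| ≤
          (γ ^ k - γ) * max (1 / (1 - γ ^ k)) (1 / γ) * ‖x‖ * ‖β₁ - β₂‖) := by
  obtain ⟨hγ0, hγ1⟩ := hγ
  obtain ⟨hk0, hk1⟩ := hk
  have hlt : γ < γ ^ k := by
    have := Real.rpow_lt_rpow_of_exponent_gt hγ0 hγ1 hk1
    rwa [Real.rpow_one] at this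
  have hlt1 : γ ^ k < 1 := Real.rpow_lt_one hγ0.le hγ1 hk0
  have f1 : ∀ (x β : EuclideanSpace ℝ (Fin d)), lfun γ k x 1 β =
      Real.log ((1 + Real.exp (-dotp x β))⁻¹ * (1 - γ)
      + (1 - (1 + Real.exp (-dotp x β))⁻¹) * (1 - γ ^ k)) := by
    intro x β
    simp [lfun]
  have f0 : ∀ (x β : EuclideanSpace ℝ (Fin d)), lfun γ k x 0 β =
      Real.log ((1 + Real.exp (-dotp x β))⁻¹ * γ
      + (1 - (1 + Real.exp (-dotp x β))⁻¹) * (γ ^ k)) := by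
    intro x β
    simp [lfun]
  have d1 := fun x : EuclideanSpace ℝ (Fin d) => core_deriv x (1 - γ) (1 - γ ^ k) (1 - γ ^ k)
    (by linarith) (by linarith) le_rfl _ (f1 x)
  have d0 := fun x : EuclideanSpace ℝ (Fin d) => core_deriv x γ (γ ^ k) γ
    hγ0 le_rfl hlt.le _ (f0 x)
  have a1 : |1 - γ - (1 - γ ^ k)| = γ ^ k - γ := by
    rw [abs_of_pos (by linarith)]
    ring
  have a0 : |γ - γ ^ k| = γ ^ k - γ := by
    rw [abs_of_neg (by linarith)]
    ring
  rw [a1] at d1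
  rw [a0] at d0
  refine ⟨?_, fun x β => ⟨(d1 x β).2, (d0 x β).2⟩, ?_⟩
  · rintro x y (rfl | rfl) β
    · rw [f0]
      obtain ⟨h1, h2⟩ := mix_bd _ γ (γ ^ k) γ (γ ^ k) (q_mem (dotp x β)) le_rfl hlt.le hlt.le le_rfl
      exact ⟨(min_le_right _ _).trans (Real.log_le_log hγ0 h1),
        (Real.log_le_log (by linarith) h2).trans (le_max_right _ _)⟩
    · rw [f1]
      obtain ⟨h1, h2⟩ := mix_bd _ (1 - γ) (1 - γ ^ k) (1 - γ ^ k) (1 - γ) (q_mem (dotp x β))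
        (by linarith) le_rfl le_rfl (by linarith)
      exact ⟨(min_le_left _ _).trans (Real.log_le_log (by linarith) h1),
        (Real.log_le_log (by linarith) h2).trans (le_max_left _ _)⟩
  · have hd : 0 ≤ γ ^ k - γ := by linarith
    rintro x y (rfl | rfl) u v
    · refine (core_lip _ _ (d0 x) u v).trans ?_
      rw [div_eq_mul_one_div]
      gcongr
      exact le_max_right _ _
    · refine (core_lip _ _ (d1 x) u v).trans ?_
      rw [div_eq_mul_one_div]
      gcongr
      exact le_max_left _ _
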